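/- arXiv:2010.12299 — 6 statements merged into one kernel-verified Lean document; each statement's English description precedes it below -/
import Mathlib

section
/- Let (θ_i)_{i∈ℤ} be a sequence of real numbers, N ∈ ℕ*, h = 1/N, and m ∈ ℕ*. The function x ↦ Σ_{i∈ℤ} θ_i χ^{*(m+1)}(x/h − i) (a pointwise finite sum, since χ^{*(m+1)} is supported in [0,m+1]) is 1-periodic if and only if the sequence (θ_i)_{i∈ℤ} is N-periodic, i.e. θ_{i+N} = θ_i for all i ∈ ℤ. -/
open MeasureTheory

noncomputable def chi : ℝ → ℝ := Set.indicator (Set.Icc (0:ℝ) 1) (fun _ => (1:ℝ))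

noncomputable def chiIter : ℕ → ℝ → ℝ
  | 0 => fun _ => 0
  | 1 => chi
  | (m+2) => fun x => ∫ t : ℝ, chiIter (m+1) t * chi (x - t)

noncomputable def chiS (s : ℝ) : ℝ → ℝ := Set.indicator (Set.Icc (0:ℝ) s) (fun _ => (1:ℝ))

noncomputable def chiSIter (s : ℝ) : ℕ → ℝ → ℝ
  | 0 => fun _ => 0
  | 1 => chiS s
  | (m+2) => fun x => ∫ t : ℝ, chiSIter s (m+1) t * chiS s (x - t)

noncomputable def omegaPT (m l : ℕ) : ℝ := ∫ t in (0:ℝ)..(l:ℝ), chiIter (m+1) t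

noncomputable def hFloor (α : ℝ) : ℕ := (⌈α⌉ - 1).toNat

noncomputable def holderSemi (α : ℝ) (E : Set ℝ) (f : ℝ → ℝ) : ℝ :=
  sSup {c : ℝ | ∃ x ∈ E, ∃ y ∈ E, x ≠ y ∧
    c = |iteratedDerivWithin (hFloor α) f E x - iteratedDerivWithin (hFloor α) f E y| /
          |x - y| ^ (α - (hFloor α : ℝ))}

def HolderMem (α : ℝ) (E : Set ℝ) (f : ℝ → ℝ) : Prop :=
  ContDiffOn ℝ (hFloor α) f E ∧
  ∃ C : ℝ, ∀ x ∈ E, ∀ y ∈ E,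
    |iteratedDerivWithin (hFloor α) f E x - iteratedDerivWithin (hFloor α) f E y|
      ≤ C * |x - y| ^ (α - (hFloor α : ℝ))

noncomputable def supDeriv (k : ℕ) (E : Set ℝ) (f : ℝ → ℝ) : ℝ :=
  sSup {c : ℝ | ∃ x ∈ E, c = |iteratedDerivWithin k f E x|}

theorem chiIter_add_two (n : ℕ) (x : ℝ) :
    chiIter (n + 2) x = ∫ t in (x - 1)..x, chiIter (n + 1) t := by
  rw [intervalIntegral.integral_of_le (by linarith), ← integral_Icc_eq_integral_Ioc,
    ← integral_indicator measurableSet_Icc]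
  simp only [chiIter]
  refine integral_congr_ae (Filter.Eventually.of_forall fun t => ?_)
  simp only [chi, Set.indicator_apply, Set.mem_Icc]
  have h : (0 ≤ x - t ∧ x - t ≤ 1) ↔ (x - 1 ≤ t ∧ t ≤ x) := by
    constructor <;> rintro ⟨h₁, h₂⟩ <;> constructor <;> linarith
  simp only [h, mul_ite, mul_one, mul_zero]

theorem continuous_chiIter_add_two_of_intervalIntegrable {n : ℕ}
    (h : ∀ a b : ℝ, IntervalIntegrable (chiIter (n + 1)) volume a b) :
    Continuous (chiIter (n + 2)) := by
  have hp := intervalIntegral.continuous_primitive h 0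
  have he : chiIter (n + 2) = fun x => (∫ t in (0 : ℝ)..x, chiIter (n + 1) t) -
      ∫ t in (0 : ℝ)..(x - 1), chiIter (n + 1) t := by
    funext x
    rw [chiIter_add_two, intervalIntegral.integral_interval_sub_left (h _ _) (h _ _)]
  rw [he]
  exact hp.sub (hp.comp (continuous_id.sub continuous_const))

theorem intervalIntegrable_chiIter (n : ℕ) (a b : ℝ) :
    IntervalIntegrable (chiIter (n + 1)) volume a b := by
  induction n generalizing a b with
  | zero =>
    exact ((integrable_indicator_iff measurableSet_Icc).2
      (integrableOn_const (by simp))).intervalIntegrable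
  | succ n ih => exact (continuous_chiIter_add_two_of_intervalIntegrable ih).intervalIntegrable a b

theorem continuous_chiIter (n : ℕ) : Continuous (chiIter (n + 2)) :=
  continuous_chiIter_add_two_of_intervalIntegrable (intervalIntegrable_chiIter n)

theorem measurable_chiIter (n : ℕ) : Measurable (chiIter (n + 1)) := by
  cases n with
  | zero => exact measurable_const.indicator measurableSet_Icc
  | succ n => exact (continuous_chiIter n).measurable

theorem continuousAt_chiIter (n : ℕ) {x : ℝ} (hx : ∀ k : ℤ, x ≠ k) :
    ContinuousAt (chiIter (n + 1)) x := by
  cases n with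
  | zero =>
    refine continuous_const.continuousOn.continuousAt_indicator ?_
    rw [frontier_Icc zero_le_one]
    rintro (h | h)
    · exact hx 0 (by simpa using h)
    · exact hx 1 (by simpa using h)
  | succ n => exact (continuous_chiIter n).continuousAt

theorem chiIter_nonneg (n : ℕ) (x : ℝ) : 0 ≤ chiIter (n + 1) x := by
  induction n generalizing x with
  | zero => exact Set.indicator_nonneg (fun _ _ => zero_le_one) x
  | succ n ih =>
    rw [chiIter_add_two]
    exact intervalIntegral.integral_nonneg (by linarith) fun t _ => ih t

theorem chiIter_pos (n : ℕ) {x : ℝ} (h₀ : 0 < x) (h₁ : x < 1) : 0 < chiIter (n + 1) x := by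
  induction n generalizing x with
  | zero => simp [chiIter, chi, h₀.le, h₁.le]
  | succ n ih =>
    rw [chiIter_add_two, ← intervalIntegral.integral_add_adjacent_intervals
      (intervalIntegrable_chiIter n (x - 1) 0) (intervalIntegrable_chiIter n 0 x)]
    refine add_pos_of_nonneg_of_pos
      (intervalIntegral.integral_nonneg (by linarith) fun t _ => chiIter_nonneg n t)
      (intervalIntegral.intervalIntegral_pos_of_pos_on (intervalIntegrable_chiIter n 0 x)
        (fun t ht => ih ht.1 (ht.2.trans h₁)) h₀)

theorem chiIter_eq_zero (n : ℕ) {x : ℝ} (hx : x < 0 ∨ (n + 1 : ℝ) < x) :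
    chiIter (n + 1) x = 0 := by
  induction n generalizing x with
  | zero =>
    refine Set.indicator_of_notMem (s := Set.Icc (0 : ℝ) 1) (fun h => ?_) (fun _ => (1 : ℝ))
    rcases hx with hx | hx
    · exact hx.not_ge h.1
    · norm_num at hx
      exact hx.not_ge h.2
  | succ n ih =>
    rw [chiIter_add_two]
    refine (intervalIntegral.integral_congr (g := fun _ => (0 : ℝ)) fun t ht => ih ?_).trans (by simp)
    rw [Set.uIcc_of_le (by linarith)] at ht
    push_cast at hx
    rcases hx with hx | hx
    · exact .inl (ht.2.trans_lt hx)
    · exact .inr (by linarith [ht.1])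

theorem hasDerivAt_chiIter (n : ℕ) {x : ℝ} (hx : ∀ k : ℤ, x ≠ k) :
    HasDerivAt (chiIter (n + 2)) (chiIter (n + 1) x - chiIter (n + 1) (x - 1)) x := by
  have hI := intervalIntegrable_chiIter n
  have hd : ∀ y : ℝ, (∀ k : ℤ, y ≠ k) →
      HasDerivAt (fun u => ∫ t in (0 : ℝ)..u, chiIter (n + 1) t) (chiIter (n + 1) y) y :=
    fun y hy => intervalIntegral.integral_hasDerivAt_right (hI _ _)
      (measurable_chiIter n).stronglyMeasurable.stronglyMeasurableAtFilter
      (continuousAt_chiIter n hy)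
  have he : chiIter (n + 2) = fun x => (∫ t in (0 : ℝ)..x, chiIter (n + 1) t) -
      ∫ t in (0 : ℝ)..(x - 1), chiIter (n + 1) t := by
    funext x
    rw [chiIter_add_two, intervalIntegral.integral_interval_sub_left (hI _ _) (hI _ _)]
  rw [he]
  refine (hd x hx).sub ((hd (x - 1) fun k hk => hx (k + 1) ?_).comp_sub_const x 1)
  push_cast
  linarith

theorem exists_finset_chiIter_sub_eq_zero (n : ℕ) (x : ℝ) :
    ∃ s : Finset ℤ, ∀ y ∈ Set.Ioo (x - 1) (x + 1), ∀ i ∉ s, chiIter (n + 1) (y - i) = 0 := by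
  refine ⟨Finset.Icc ⌊x - 1 - (n + 1)⌋ ⌈x + 1⌉, fun y hy i hi => chiIter_eq_zero n ?_⟩
  rw [Finset.mem_Icc, not_and_or, not_le, not_le] at hi
  rcases hi with hi | hi
  · have := Int.lt_floor_iff.1 hi
    exact .inr (by linarith [hy.1])
  · have := Int.ceil_lt_iff.1 hi
    exact .inl (by linarith [hy.2])

theorem summable_mul_chiIter (n : ℕ) (c : ℤ → ℝ) (x : ℝ) :
    Summable fun i : ℤ => c i * chiIter (n + 1) (x - i) := by
  obtain ⟨s, hs⟩ := exists_finset_chiIter_sub_eq_zero n x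
  refine summable_of_ne_finset_zero (s := s) fun i hi => ?_
  rw [hs x ⟨by linarith, by linarith⟩ i hi, mul_zero]

theorem tsum_mul_chiIter_add_int (n : ℕ) (c : ℤ → ℝ) (x : ℝ) (k : ℤ) :
    ∑' i : ℤ, c i * chiIter (n + 1) (x + k - i) =
      ∑' i : ℤ, c (i + k) * chiIter (n + 1) (x - i) := by
  rw [← (Equiv.addRight k).tsum_eq]
  refine tsum_congr fun i => ?_
  simp only [Equiv.coe_addRight, Int.cast_add, add_sub_add_right_eq_sub]

theorem tsum_chiIter_pos (n : ℕ) {x : ℝ} (hx : ∀ k : ℤ, x ≠ k) :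
    0 < ∑' i : ℤ, chiIter (n + 1) (x - i) := by
  have hs : Summable fun i : ℤ => chiIter (n + 1) (x - i) := by
    simpa using summable_mul_chiIter n (fun _ => 1) x
  refine hs.tsum_pos (fun i => chiIter_nonneg n _) ⌊x⌋ (chiIter_pos n ?_ ?_)
  · exact sub_pos.2 (lt_of_le_of_ne (Int.floor_le x) (hx _).symm)
  · linarith [Int.lt_floor_add_one x]

theorem hasDerivAt_tsum_mul_chiIter (n : ℕ) (c : ℤ → ℝ) {x : ℝ} (hx : ∀ k : ℤ, x ≠ k) :
    HasDerivAt (fun y => ∑' i : ℤ, c i * chiIter (n + 2) (y - i))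
      (∑' i : ℤ, (c i - c (i - 1)) * chiIter (n + 1) (x - i)) x := by
  obtain ⟨s, hs⟩ := exists_finset_chiIter_sub_eq_zero (n + 1) x
  have hnhds : Set.Ioo (x - 1) (x + 1) ∈ nhds x := Ioo_mem_nhds (by linarith) (by linarith)
  have hterm : ∀ i : ℤ, HasDerivAt (fun y => c i * chiIter (n + 2) (y - i))
      (c i * (chiIter (n + 1) (x - i) - chiIter (n + 1) (x - i - 1))) x := fun i =>
    ((hasDerivAt_chiIter n fun k hk => hx (k + i) (by push_cast; linarith)).comp_sub_const
      x (i : ℝ)).const_mul (c i)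
  have hsum := HasDerivAt.fun_sum fun i (_ : i ∈ s) => hterm i
  have heq : (fun y => ∑' i : ℤ, c i * chiIter (n + 2) (y - i)) =ᶠ[nhds x]
      fun y => ∑ i ∈ s, c i * chiIter (n + 2) (y - i) := by
    filter_upwards [hnhds] with y hy
    exact tsum_eq_sum fun i hi => by rw [hs y hy i hi, mul_zero]
  have hzero : ∀ i ∉ s, c i * (chiIter (n + 1) (x - i) - chiIter (n + 1) (x - i - 1)) = 0 := by
    intro i hi
    refine (hterm i).unique ((hasDerivAt_const x (0 : ℝ)).congr_of_eventuallyEq ?_)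
    filter_upwards [hnhds] with y hy
    rw [hs y hy i hi, mul_zero]
  refine (hsum.congr_of_eventuallyEq heq).congr_deriv ?_
  refine (tsum_eq_sum (L := .unconditional ℤ) hzero).symm.trans ?_
  have h₁ := summable_mul_chiIter n c x
  have h₂ := summable_mul_chiIter n c (x - 1)
  have h₃ := summable_mul_chiIter n (fun i => c (i - 1)) x
  have h₄ := tsum_mul_chiIter_add_int n c x (-1)
  simp only [Int.cast_neg, Int.cast_one, ← sub_eq_add_neg] at h₄
  simp only [sub_mul, mul_sub, sub_right_comm x _ (1 : ℝ)]
  rw [h₁.tsum_sub h₂, h₁.tsum_sub h₃, h₄]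

theorem eq_zero_of_tsum_mul_chiIter_eq_zero (n : ℕ) {c : ℤ → ℝ}
    (h : ∀ x : ℝ, (∀ k : ℤ, x ≠ k) → ∑' i : ℤ, c i * chiIter (n + 1) (x - i) = 0) (j : ℤ) :
    c j = 0 := by
  have hhalf : ∀ j k : ℤ, (j : ℝ) + 1 / 2 ≠ k := by
    intro j k hjk
    have h₂ : (2 * j + 1 : ℝ) = 2 * k := by linarith
    norm_cast at h₂
    omega
  induction n generalizing c j with
  | zero =>
    have hj := h (j + 1 / 2) (hhalf j)
    rw [tsum_eq_single j] at hj
    · rw [add_sub_cancel_left] at hj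
      exact (mul_eq_zero.1 hj).resolve_right
        (chiIter_pos 0 (by norm_num) (by norm_num)).ne'
    · intro i hi
      rw [chiIter_eq_zero 0, mul_zero]
      rcases hi.lt_or_gt with hi | hi
      · have : (i + 1 : ℝ) ≤ j := by exact_mod_cast hi
        exact .inr (by norm_num; linarith)
      · have : (j + 1 : ℝ) ≤ i := by exact_mod_cast hi
        exact .inl (by linarith)
  | succ n ih =>
    have hstep : ∀ i, c i = c (i - 1) := fun i => by
      refine sub_eq_zero.1 (ih (c := fun i => c i - c (i - 1)) (fun x hx => ?_) i)
      refine (hasDerivAt_tsum_mul_chiIter n c hx).unique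
        ((hasDerivAt_const x (0 : ℝ)).congr_of_eventuallyEq ?_)
      have hopen : IsOpen (Set.range ((↑) : ℤ → ℝ))ᶜ :=
        Int.isClosedEmbedding_coe_real.isClosed_range.isOpen_compl
      filter_upwards [hopen.mem_nhds (x := x) (by rintro ⟨k, hk⟩; exact hx k hk.symm)] with y hy
      exact h y fun k hk => hy ⟨k, hk.symm⟩
    have hconst : ∀ i, c i = c j := fun i => by
      induction i using Int.inductionOn' (b := j) with
      | zero => rfl
      | succ k _ hk => rw [hstep, add_sub_cancel_right, hk]
      | pred k _ hk => rw [← hstep, hk]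
    have hj := h _ (hhalf 0)
    simp only [hconst, tsum_mul_left] at hj
    exact (mul_eq_zero.1 hj).resolve_right (tsum_chiIter_pos _ (hhalf 0)).ne'

theorem stmt7 (θ : ℤ → ℝ) (N : ℕ) (hN : 0 < N) (m : ℕ) (hm : 1 ≤ m) :
    Function.Periodic
        (fun x : ℝ => ∑' i : ℤ, θ i * chiIter (m+1) (x / ((1:ℝ) / N) - (i:ℝ))) 1
      ↔ ∀ i : ℤ, θ (i + (N : ℤ)) = θ i := by
  have hN₀ : (N : ℝ) ≠ 0 := by exact_mod_cast hN.ne'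
  have hshift : ∀ y : ℝ, ∑' i : ℤ, θ i * chiIter (m + 1) (y + N - i) =
      ∑' i : ℤ, θ (i + N) * chiIter (m + 1) (y - i) := fun y => by
    simpa using tsum_mul_chiIter_add_int m θ y N
  have hdiv : ∀ x : ℝ, (x + 1) / ((1 : ℝ) / N) = x / ((1 : ℝ) / N) + N := fun x => by
    field_simp
  simp only [Function.Periodic, hdiv, hshift]
  refine ⟨fun h i => ?_, fun h x => by simp only [h]⟩
  refine sub_eq_zero.1 (eq_zero_of_tsum_mul_chiIter_eq_zero m
    (c := fun i => θ (i + N) - θ i) (fun y _ => ?_) i)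
  have hy := h (y / N)
  rw [show y / N / ((1 : ℝ) / N) = y by field_simp] at hy
  simp only [sub_mul]
  rw [(summable_mul_chiIter m (fun i => θ (i + N)) y).tsum_sub (summable_mul_chiIter m θ y), hy,
    sub_self]
end

section
/- Let l ∈ ℕ* and l' > 0, and let f : [0,1) → [0,l'] be constant on each interval [i/l, (i+1)/l) for i = 0,…,l−1. Let g : ℝ → [0,l'] be the 1-periodic extension of f. Then for every m ∈ ℕ*, s > 0 and q ∈ ℕ*, sup_{x∈ℝ} | s^{-m} (χ_s^{*m} * g)(x) − q^{-m} Σ_{(i_1,…,i_m)∈{0,…,q−1}^m} g( x − (i_1+⋯+i_m) s / q ) | ≤ m l' (l s + 1) / q. -/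
open MeasureTheory

/-- The average of `h` over `[x - s, x]`. -/
noncomputable def contAvg (s : ℝ) (h : ℝ → ℝ) (x : ℝ) : ℝ :=
  s⁻¹ * ∫ t : ℝ, chiS s t * h (x - t)

/-- The average of the values of `h` at the points `x - i s / q`, `i < q`. -/
noncomputable def shiftAvg (s : ℝ) (q : ℕ) (h : ℝ → ℝ) (x : ℝ) : ℝ :=
  (q : ℝ)⁻¹ * ∑ i : Fin q, h (x - ((i : ℕ) : ℝ) * s / q)

/-- The closed form of the `m`-fold iterate of `shiftAvg`. -/
noncomputable def shiftAvgIter (s : ℝ) (q m : ℕ) (h : ℝ → ℝ) (x : ℝ) : ℝ :=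
  ((q : ℝ) ^ m)⁻¹ * ∑ v : Fin m → Fin q, h (x - (∑ j, ((v j : ℕ) : ℝ)) * s / q)

lemma chiS_nonneg (s t : ℝ) : 0 ≤ chiS s t :=
  Set.indicator_nonneg (fun _ _ => zero_le_one) t

lemma integrable_chiS (s : ℝ) : Integrable (chiS s) := by
  unfold chiS
  rw [integrable_indicator_iff measurableSet_Icc]
  exact integrableOn_const (by simp)

lemma measurable_chiS (s : ℝ) : Measurable (chiS s) :=
  measurable_const.indicator measurableSet_Icc

lemma integral_chiS {s : ℝ} (hs : 0 < s) : ∫ t, chiS s t = s := by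
  unfold chiS
  rw [integral_indicator measurableSet_Icc]
  simp [hs.le]

lemma integrable_chiSIter (s : ℝ) (m : ℕ) : Integrable (chiSIter s m) := by
  induction m with
  | zero => exact integrable_zero _ _ _
  | succ m ih =>
    cases m with
    | zero => exact integrable_chiS s
    | succ m =>
      exact ih.integrable_convolution (ContinuousLinearMap.mul ℝ ℝ) (integrable_chiS s)

lemma integrable_mul_comp_const_sub {F h : ℝ → ℝ} (hF : Integrable F) (hm : Measurable h)
    {C : ℝ} (hC : ∀ x, |h x| ≤ C) (x : ℝ) : Integrable (fun t => F t * h (x - t)) :=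
  hF.mul_bdd (c := C)
    (hm.comp (measurable_const.sub measurable_id)).aestronglyMeasurable
    (Filter.Eventually.of_forall fun _ => hC _)

lemma measurable_contAvg (s : ℝ) {h : ℝ → ℝ} (hm : Measurable h) :
    Measurable (contAvg s h) := by
  unfold contAvg
  refine Measurable.const_mul ?_ _
  have hp : StronglyMeasurable (fun p : ℝ × ℝ => chiS s p.2 * h (p.1 - p.2)) :=
    (((measurable_chiS s).comp measurable_snd).mul
      (hm.comp (measurable_fst.sub measurable_snd))).stronglyMeasurable
  exact hp.integral_prod_right.measurable

lemma measurable_shiftAvg (s : ℝ) (q : ℕ) {h : ℝ → ℝ} (hm : Measurable h) :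
    Measurable (shiftAvg s q h) := by
  unfold shiftAvg
  fun_prop

lemma abs_contAvg_le {s : ℝ} (hs : 0 < s) {h : ℝ → ℝ} {C : ℝ} (hC : ∀ x, |h x| ≤ C) (x : ℝ) :
    |contAvg s h x| ≤ C := by
  have key : |∫ t : ℝ, chiS s t * h (x - t)| ≤ ∫ t, chiS s t * C := by
    rw [← Real.norm_eq_abs]
    refine norm_integral_le_of_norm_le ((integrable_chiS s).mul_const C)
      (Filter.Eventually.of_forall fun t => ?_)
    rw [Real.norm_eq_abs, abs_mul, abs_of_nonneg (chiS_nonneg s t)]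
    exact mul_le_mul_of_nonneg_left (hC _) (chiS_nonneg s t)
  rw [integral_mul_const, integral_chiS hs] at key
  rw [contAvg, abs_mul, abs_of_pos (inv_pos.2 hs)]
  exact (inv_mul_le_iff₀ hs).2 key

lemma abs_shiftAvgIter_le (s : ℝ) {q : ℕ} (hq : 0 < q) (m : ℕ) {h : ℝ → ℝ} {C : ℝ}
    (hC : ∀ x, |h x| ≤ C) (x : ℝ) : |shiftAvgIter s q m h x| ≤ C := by
  have hq' : (0 : ℝ) < (q : ℝ) ^ m := by positivity
  rw [shiftAvgIter, abs_mul, abs_of_pos (inv_pos.2 hq'), inv_mul_le_iff₀ hq']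
  refine (Finset.abs_sum_le_sum_abs _ _).trans
    ((Finset.sum_le_card_nsmul _ _ C fun v _ => hC _).trans ?_)
  simp

lemma shiftAvgIter_one (s : ℝ) (q : ℕ) (h : ℝ → ℝ) :
    shiftAvgIter s q 1 h = shiftAvg s q h := by
  funext x
  unfold shiftAvgIter shiftAvg
  rw [pow_one, ← (Equiv.funUnique (Fin 1) (Fin q)).symm.sum_comp]
  simp

lemma abs_shiftAvg_le (s : ℝ) {q : ℕ} (hq : 0 < q) {h : ℝ → ℝ} {C : ℝ}
    (hC : ∀ x, |h x| ≤ C) (x : ℝ) : |shiftAvg s q h x| ≤ C := by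
  rw [← shiftAvgIter_one]
  exact abs_shiftAvgIter_le s hq 1 hC x

lemma shiftAvgIter_succ (s : ℝ) (q m : ℕ) (h : ℝ → ℝ) (x : ℝ) :
    shiftAvgIter s q (m + 1) h x = shiftAvgIter s q m (shiftAvg s q h) x := by
  unfold shiftAvgIter shiftAvg
  rw [← (Fin.consEquiv fun _ => Fin q).sum_comp, Fintype.sum_prod_type, Finset.sum_comm,
    ← Finset.mul_sum, ← mul_assoc, pow_succ, mul_inv]
  congr 1
  refine Finset.sum_congr rfl fun v _ => Finset.sum_congr rfl fun i _ => ?_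
  congr 1
  simp only [Fin.consEquiv, Equiv.coe_fn_mk, Fin.sum_univ_succ, Fin.cons_zero, Fin.cons_succ]
  ring

lemma shiftAvgIter_sub (s : ℝ) (q m : ℕ) (h k : ℝ → ℝ) (x : ℝ) :
    shiftAvgIter s q m (fun y => h y - k y) x =
      shiftAvgIter s q m h x - shiftAvgIter s q m k x := by
  simp only [shiftAvgIter, Finset.sum_sub_distrib, mul_sub]

lemma contAvg_sub (s : ℝ) {h k : ℝ → ℝ} (hm : Measurable h) (km : Measurable k) {C D : ℝ}
    (hC : ∀ x, |h x| ≤ C) (kD : ∀ x, |k x| ≤ D) (x : ℝ) :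
    contAvg s (fun y => h y - k y) x = contAvg s h x - contAvg s k x := by
  unfold contAvg
  rw [← mul_sub, ← integral_sub (integrable_mul_comp_const_sub (integrable_chiS s) hm hC x)
    (integrable_mul_comp_const_sub (integrable_chiS s) km kD x)]
  simp only [mul_sub]

lemma shiftAvg_contAvg (s : ℝ) (q : ℕ) {h : ℝ → ℝ} (hm : Measurable h) {C : ℝ}
    (hC : ∀ x, |h x| ≤ C) (x : ℝ) :
    shiftAvg s q (contAvg s h) x = contAvg s (shiftAvg s q h) x := by
  unfold shiftAvg contAvg
  rw [← Finset.mul_sum, ← integral_finsetSum _ fun i _ =>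
    integrable_mul_comp_const_sub (integrable_chiS s) hm hC _, mul_left_comm,
    ← integral_const_mul]
  congr 2
  funext t
  rw [← Finset.mul_sum, mul_left_comm]
  simp only [sub_right_comm x _ t]

lemma integral_chiSIter_succ {s : ℝ} (hs : 0 < s) (m : ℕ) {h : ℝ → ℝ} (hm : Measurable h) {C : ℝ}
    (hC : ∀ x, |h x| ≤ C) (x : ℝ) :
    ∫ u : ℝ, chiSIter s (m + 2) u * h (x - u) =
      s * ∫ t : ℝ, chiSIter s (m + 1) t * contAvg s h (x - t) := by
  have hint : Integrable (fun p : ℝ × ℝ =>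
      chiSIter s (m + 1) p.2 * chiS s (p.1 - p.2) * h (x - p.1)) (volume.prod volume) :=
    (Integrable.convolution_integrand (ContinuousLinearMap.mul ℝ ℝ)
      (integrable_chiSIter s (m + 1)) (integrable_chiS s)).mul_bdd (c := C)
      (hm.comp (measurable_const.sub measurable_fst)).aestronglyMeasurable
      (Filter.Eventually.of_forall fun p => hC _)
  calc ∫ u : ℝ, chiSIter s (m + 2) u * h (x - u)
      = ∫ u : ℝ, ∫ t : ℝ, chiSIter s (m + 1) t * chiS s (u - t) * h (x - u) := by
        simp only [chiSIter, integral_mul_const]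
    _ = ∫ t : ℝ, ∫ u : ℝ, chiSIter s (m + 1) t * chiS s (u - t) * h (x - u) :=
        integral_integral_swap hint
    _ = ∫ t : ℝ, s * (chiSIter s (m + 1) t * contAvg s h (x - t)) := by
        congr 1
        funext t
        rw [← integral_add_right_eq_self _ t]
        simp only [add_sub_cancel_right, mul_assoc, integral_const_mul, contAvg]
        rw [mul_left_comm s, mul_inv_cancel_left₀ hs.ne']
        simp only [sub_add_eq_sub_sub_swap]
    _ = _ := integral_const_mul _ _

theorem abs_chiSIter_sub_shiftAvgIter_le {s : ℝ} (hs : 0 < s) {q : ℕ} (hq : 0 < q) {ε : ℝ}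
    (m : ℕ) {h : ℝ → ℝ} (hm : Measurable h) {C : ℝ} (hC : ∀ x, |h x| ≤ C)
    (hε : ∀ x, |contAvg s h x - shiftAvg s q h x| ≤ ε) (x : ℝ) :
    |(s ^ (m + 1))⁻¹ * (∫ t : ℝ, chiSIter s (m + 1) t * h (x - t)) -
      shiftAvgIter s q (m + 1) h x| ≤ ((m : ℝ) + 1) * ε := by
  induction m generalizing h with
  | zero => simpa [shiftAvgIter_one, contAvg, chiSIter] using hε x
  | succ m ih =>
    have hstep : ∀ y, |contAvg s (contAvg s h) y - shiftAvg s q (contAvg s h) y| ≤ ε := by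
      intro y
      rw [shiftAvg_contAvg s q hm hC, ← contAvg_sub s (measurable_contAvg s hm)
        (measurable_shiftAvg s q hm) (abs_contAvg_le hs hC) (abs_shiftAvg_le s hq hC)]
      exact abs_contAvg_le hs hε y
    have h₁ := ih (measurable_contAvg s hm) (abs_contAvg_le hs hC) hstep
    have h₂ := abs_shiftAvgIter_le s hq (m + 1) hε x
    rw [shiftAvgIter_sub, ← shiftAvgIter_succ] at h₂
    have h₃ : (s ^ (m + 1 + 1))⁻¹ * (∫ t : ℝ, chiSIter s (m + 1 + 1) t * h (x - t)) =
        (s ^ (m + 1))⁻¹ * ∫ t : ℝ, chiSIter s (m + 1) t * contAvg s h (x - t) := by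
      rw [integral_chiSIter_succ hs m hm hC, pow_succ s (m + 1), mul_inv, mul_assoc,
        inv_mul_cancel_left₀ hs.ne']
    rw [h₃]
    refine (abs_sub_le _ (shiftAvgIter s q (m + 1) (contAvg s h) x) _).trans ?_
    push_cast
    linarith

lemma eq_apply_floor_div {l : ℕ} (hl : 0 < l) {f g : ℝ → ℝ}
    (hfc : ∀ i : ℕ, i < l → ∀ x ∈ Set.Ico ((i:ℝ) / l) (((i:ℝ) + 1) / l),
        ∀ y ∈ Set.Ico ((i:ℝ) / l) (((i:ℝ) + 1) / l), f x = f y)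
    (hgper : ∀ x : ℝ, g (x + 1) = g x) (hgf : ∀ x ∈ Set.Ico (0:ℝ) 1, g x = f x) (x : ℝ) :
    g x = g ((⌊(l : ℝ) * x⌋ : ℝ) / l) := by
  have hl' : (0 : ℝ) < l := by exact_mod_cast hl
  have hper : Function.Periodic g 1 := hgper
  have hfr : g x = g (Int.fract x) := by
    have := hper.sub_int_mul_eq (x := x) ⌊x⌋
    rw [mul_one] at this
    exact this.symm
  obtain ⟨i, hi⟩ : ∃ i : ℕ, (i : ℤ) = ⌊(l : ℝ) * Int.fract x⌋ :=
    ⟨_, Int.toNat_of_nonneg (Int.floor_nonneg.2 (mul_nonneg hl'.le (Int.fract_nonneg x)))⟩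
  have hi₁ : (i : ℝ) ≤ l * Int.fract x := by
    have := Int.floor_le ((l : ℝ) * Int.fract x)
    rw [← hi] at this
    exact_mod_cast this
  have hi₂ : (l : ℝ) * Int.fract x < i + 1 := by
    have := Int.lt_floor_add_one ((l : ℝ) * Int.fract x)
    rw [← hi] at this
    exact_mod_cast this
  have hil : (i : ℝ) < l := by nlinarith [Int.fract_lt_one x]
  have hfloor : (⌊(l : ℝ) * x⌋ : ℝ) / l = i / l + (⌊x⌋ : ℤ) := by
    have : ⌊(l : ℝ) * x⌋ = i + l * ⌊x⌋ := by
      rw [hi, ← Int.floor_add_intCast]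
      congr 1
      push_cast
      rw [← mul_add, Int.fract_add_floor]
    rw [this]
    push_cast
    field_simp
  have hgi : g ((i : ℝ) / l + (⌊x⌋ : ℤ)) = g ((i : ℝ) / l) := by
    have := hper.int_mul ⌊x⌋ ((i : ℝ) / l)
    rwa [mul_one] at this
  rw [hfloor, hgi, hfr, hgf _ ⟨Int.fract_nonneg x, Int.fract_lt_one x⟩,
    hgf _ ⟨by positivity, (div_lt_one hl').2 hil⟩]
  refine hfc i (by exact_mod_cast hil) _ ⟨?_, ?_⟩ _ ⟨le_rfl, ?_⟩
  · rwa [div_le_iff₀' hl']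
  · rwa [lt_div_iff₀' hl']
  · gcongr
    linarith

lemma abs_contAvg_sub_shiftAvg_le {s : ℝ} (hs : 0 < s) {q : ℕ} (hq : 0 < q) {l : ℕ} {l' : ℝ}
    (hl' : 0 ≤ l') {g : ℝ → ℝ} (hm : Measurable g) (hgb : ∀ x, g x ∈ Set.Icc 0 l')
    (hg : ∀ x y : ℝ, ⌊(l : ℝ) * x⌋ = ⌊(l : ℝ) * y⌋ → g x = g y) (x : ℝ) :
    |contAvg s g x - shiftAvg s q g x| ≤ l' * ((l : ℝ) * s + 1) / q := by
  have hq' : (0 : ℝ) < q := by exact_mod_cast hq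
  set p : ℕ → ℝ := fun i => (i : ℝ) * s / q with hp
  have hp0 : p 0 = 0 := by simp [hp]
  have hpq : p q = s := by simp only [hp]; field_simp
  have hpd : ∀ i, p (i + 1) - p i = s / q := fun i => by simp only [hp]; push_cast; ring
  have hple : ∀ i, p i ≤ p (i + 1) := fun i => by
    have := hpd i
    have : 0 < s / q := by positivity
    linarith
  set N : ℕ → ℝ := fun i => (⌊(l : ℝ) * (x - p i)⌋ : ℝ) with hN
  have hII : ∀ a b : ℝ, IntervalIntegrable (fun t => g (x - t)) volume a b := fun a b =>
    (intervalIntegrable_const (c := l')).mono_fun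
      (hm.comp (measurable_const.sub measurable_id)).aestronglyMeasurable
      (Filter.Eventually.of_forall fun t => by
        simp only [Real.norm_eq_abs]
        rw [abs_of_nonneg (hgb _).1, abs_of_nonneg hl']
        exact (hgb _).2)
  have hcont : ∫ t : ℝ, chiS s t * g (x - t) =
      ∑ i ∈ Finset.range q, ∫ t in p i..p (i + 1), g (x - t) := by
    rw [intervalIntegral.sum_integral_adjacent_intervals fun i _ => hII _ _, hp0, hpq,
      intervalIntegral.integral_of_le hs.le, ← integral_Icc_eq_integral_Ioc,
      ← integral_indicator measurableSet_Icc]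
    congr 1
    funext t
    by_cases ht : t ∈ Set.Icc 0 s <;> simp [chiS, ht]
  have hpiece : ∀ i, |(∫ t in p i..p (i + 1), g (x - t)) - s / q * g (x - p i)| ≤
      l' * (N i - N (i + 1)) * (s / q) := by
    intro i
    have hconst : s / q * g (x - p i) = ∫ _ in p i..p (i + 1), g (x - p i) := by
      rw [intervalIntegral.integral_const, hpd, smul_eq_mul]
    rw [hconst, ← intervalIntegral.integral_sub (hII _ _) intervalIntegrable_const]
    have := intervalIntegral.norm_integral_le_of_norm_le_const
      (f := fun t => g (x - t) - g (x - p i)) (a := p i) (b := p (i + 1))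
      (C := l' * (N i - N (i + 1))) ?_
    · rwa [hpd, abs_of_pos (by positivity : 0 < s / (q : ℝ))] at this
    intro t ht
    rw [Set.uIoc_of_le (hple i)] at ht
    have hlo : ⌊(l : ℝ) * (x - p (i + 1))⌋ ≤ ⌊(l : ℝ) * (x - t)⌋ := by
      have := ht.2
      gcongr
    have hhi : ⌊(l : ℝ) * (x - t)⌋ ≤ ⌊(l : ℝ) * (x - p i)⌋ := by
      have := ht.1.le
      gcongr
    rw [Real.norm_eq_abs]
    rcases (hlo.trans hhi).eq_or_lt with heq | hlt
    · rw [hg (x - t) (x - p i) (by omega)]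
      simp [hN, heq]
    · have h1 : (1 : ℝ) ≤ N i - N (i + 1) := by
        have : (1 : ℤ) ≤ ⌊(l : ℝ) * (x - p i)⌋ - ⌊(l : ℝ) * (x - p (i + 1))⌋ := by omega
        simp only [hN]
        exact_mod_cast this
      have h2 : |g (x - t) - g (x - p i)| ≤ l' := by
        have h3 := hgb (x - t)
        have h4 := hgb (x - p i)
        rw [abs_le]
        constructor <;> linarith [h3.1, h3.2, h4.1, h4.2]
      nlinarith
  have hdiff : contAvg s g x - shiftAvg s q g x =
      s⁻¹ * ∑ i ∈ Finset.range q, ((∫ t in p i..p (i + 1), g (x - t)) - s / q * g (x - p i)) := by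
    rw [contAvg, shiftAvg, hcont, Fin.sum_univ_eq_sum_range fun i => g (x - (i : ℝ) * s / q),
      Finset.sum_sub_distrib, ← Finset.mul_sum, mul_sub]
    rw [← mul_assoc, div_eq_mul_inv, inv_mul_cancel_left₀ hs.ne']
  have hsum : |∑ i ∈ Finset.range q,
      ((∫ t in p i..p (i + 1), g (x - t)) - s / q * g (x - p i))| ≤
      l' * (N 0 - N q) * (s / q) := by
    refine (Finset.abs_sum_le_sum_abs _ _).trans
      ((Finset.sum_le_sum fun i _ => hpiece i).trans_eq ?_)
    rw [← Finset.sum_mul, ← Finset.mul_sum, Finset.sum_range_sub']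
  have hNN : N 0 - N q ≤ l * s + 1 := by
    have h1 := Int.floor_le ((l : ℝ) * (x - p 0))
    have h2 := Int.lt_floor_add_one ((l : ℝ) * (x - p q))
    simp only [hN]
    rw [hp0] at h1 ⊢
    rw [hpq] at h2 ⊢
    linarith
  rw [hdiff, abs_mul, abs_of_pos (inv_pos.2 hs), inv_mul_le_iff₀ hs]
  calc _ ≤ l' * (N 0 - N q) * (s / q) := hsum
    _ ≤ l' * (l * s + 1) * (s / q) := by gcongr
    _ = _ := by ring

theorem stmt9 (l : ℕ) (hl : 0 < l) (l' : ℝ) (hl' : 0 < l')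
    (f : ℝ → ℝ)
    (hfc : ∀ i : ℕ, i < l → ∀ x ∈ Set.Ico ((i:ℝ) / l) (((i:ℝ) + 1) / l),
        ∀ y ∈ Set.Ico ((i:ℝ) / l) (((i:ℝ) + 1) / l), f x = f y)
    (hfb : ∀ x ∈ Set.Ico (0:ℝ) 1, f x ∈ Set.Icc 0 l')
    (g : ℝ → ℝ) (hgb : ∀ x : ℝ, g x ∈ Set.Icc 0 l')
    (hgper : ∀ x : ℝ, g (x + 1) = g x) (hgf : ∀ x ∈ Set.Ico (0:ℝ) 1, g x = f x) :
    ∀ m : ℕ, 1 ≤ m → ∀ s : ℝ, 0 < s → ∀ q : ℕ, 0 < q → ∀ x : ℝ,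
      |s ^ (-(m:ℤ)) * (∫ t : ℝ, chiSIter s m t * g (x - t)) -
          ((q:ℝ)^m)⁻¹ * ∑ v : Fin m → Fin q, g (x - (∑ j, ((v j : ℕ) : ℝ)) * s / q)|
        ≤ (m:ℝ) * l' * ((l:ℝ) * s + 1) / q := by
  intro m hm s hs q hq x
  have hfl := eq_apply_floor_div hl hfc hgper hgf
  have hgm : Measurable g := by
    have : g = (fun k : ℤ => g ((k : ℝ) / l)) ∘ fun y => ⌊(l : ℝ) * y⌋ := funext hfl
    rw [this]
    exact (measurable_from_top).comp (measurable_id.const_mul _).floor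
  have hbd : ∀ y, |g y| ≤ l' := fun y => by
    rw [abs_of_nonneg (hgb y).1]
    exact (hgb y).2
  obtain ⟨k, rfl⟩ : ∃ k, m = k + 1 := ⟨m - 1, by omega⟩
  have key := abs_chiSIter_sub_shiftAvgIter_le hs hq k hgm hbd
    (abs_contAvg_sub_shiftAvg_le hs hq hl'.le hgm hgb fun y z hyz => by
      rw [hfl y, hfl z, hyz]) x
  rw [zpow_neg, zpow_natCast]
  refine key.trans_eq ?_
  push_cast
  ring
end

section
/- Let E ⊆ ℝ be a nonempty interval, α > 0, k = ⌊α⌋, and let f0 ∈ Σ(α,E) with Hölder seminorm ‖f0‖_{Σ(α)}. Then there exists a function f̃ : ℝ → ℝ that is k times differentiable on ℝ, coincides with f0 on E, and satisfies f̃ ∈ Σ(α,ℝ) with ‖f̃‖_{Σ(α)} = ‖f0‖_{Σ(α)}; that is, sup_{x≠y in ℝ} |f̃^{(k)}(x) − f̃^{(k)}(y)| / |x−y|^{α−k} = ‖f0‖_{Σ(α)}. -/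
open MeasureTheory

/-- McShane extension for Hölder functions: the Hölder constant is preserved. -/
theorem exists_holder_extension {β C : ℝ} (hβ₀ : 0 < β) (hβ₁ : β ≤ 1) (hC : 0 ≤ C)
    {E : Set ℝ} {g : ℝ → ℝ} (hg : ∀ x ∈ E, ∀ y ∈ E, |g x - g y| ≤ C * |x - y| ^ β) :
    ∃ G : ℝ → ℝ, Set.EqOn g G E ∧ ∀ x y, |G x - G y| ≤ C * |x - y| ^ β := by
  let π : Metric.Snowflaking ℝ β hβ₀ hβ₁ → ℝ := Metric.Snowflaking.ofSnowflaking
  have hL : LipschitzOnWith ⟨C, hC⟩ (g ∘ π) (π ⁻¹' E) :=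
    LipschitzOnWith.of_dist_le_mul fun x hx y hy => hg (π x) hx (π y) hy
  obtain ⟨G, hG, hGE⟩ := hL.extend_real
  exact ⟨fun x => G (Metric.Snowflaking.toSnowflaking x),
    fun x hx => hGE (x := Metric.Snowflaking.toSnowflaking x) hx,
    fun x y => hG.dist_le_mul (Metric.Snowflaking.toSnowflaking x)
      (Metric.Snowflaking.toSnowflaking y)⟩

theorem continuous_of_holder_bound {β C : ℝ} (hβ₀ : 0 < β) {G : ℝ → ℝ}
    (hG : ∀ x y, |G x - G y| ≤ C * |x - y| ^ β) : Continuous G := by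
  refine continuous_iff_continuousAt.2 fun y => tendsto_iff_dist_tendsto_zero.2 ?_
  have h : Continuous fun x : ℝ => C * |x - y| ^ β :=
    continuous_const.mul ((continuous_id.sub continuous_const).abs.rpow_const
      fun _ => Or.inr hβ₀.le)
  refine squeeze_zero (fun _ => dist_nonneg) (fun x => hG x y) ?_
  simpa [Real.zero_rpow hβ₀.ne'] using h.tendsto y

/-- A `C^k` function on a nondegenerate interval extends to a `C^k` function on the line with
any prescribed continuous extension of its `k`-th derivative. -/
theorem exists_contDiff_extension {E : Set ℝ} (hE : Convex ℝ E) (hU : UniqueDiffOn ℝ E)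
    (hne : E.Nonempty) {G : ℝ → ℝ} (hG : Continuous G) (k : ℕ) :
    ∀ f : ℝ → ℝ, ContDiffOn ℝ k f E → Set.EqOn (iteratedDerivWithin k f E) G E →
      ∃ F : ℝ → ℝ, ContDiff ℝ k F ∧ Set.EqOn F f E ∧ iteratedDeriv k F = G := by
  obtain ⟨x₀, hx₀⟩ := hne
  induction k with
  | zero =>
    intro f _ hfG
    refine ⟨G, contDiff_zero.2 hG, fun x hx => ?_, iteratedDeriv_zero⟩
    simpa using (hfG hx).symm
  | succ k ih =>
    intro f hf hfG
    rw [Nat.cast_add, Nat.cast_one] at hf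
    obtain ⟨hfd, -, hf'⟩ := (contDiffOn_succ_iff_derivWithin hU).1 hf
    rw [iteratedDerivWithin_succ'] at hfG
    obtain ⟨F, hF, hFf, hFG⟩ := ih _ hf' hfG
    have hder : ∀ x, HasDerivAt (fun x => f x₀ + ∫ t in x₀..x, F t) (F x) x := fun x =>
      (hF.continuous.integral_hasStrictDerivAt x₀ x).hasDerivAt.const_add _
    have hderiv : deriv (fun x => f x₀ + ∫ t in x₀..x, F t) = F :=
      funext fun x => (hder x).deriv
    have hdiff : Differentiable ℝ (fun x => f x₀ + ∫ t in x₀..x, F t) :=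
      fun x => (hder x).differentiableAt
    refine ⟨fun x => f x₀ + ∫ t in x₀..x, F t, ?_, ?_, ?_⟩
    · rw [Nat.cast_add, Nat.cast_one]
      refine contDiff_succ_iff_deriv.2 ⟨hdiff, by simp, by rwa [hderiv]⟩
    · refine hE.eqOn_of_fderivWithin_eq hdiff.differentiableOn hfd hU (fun x hx => ?_) hx₀
        (by simp)
      rw [← toSpanSingleton_derivWithin, ← toSpanSingleton_derivWithin,
        (hder x).hasDerivWithinAt.derivWithin (hU x hx), hFf hx]
    · rw [iteratedDeriv_succ', hderiv, hFG]

theorem hFloor_lt {α : ℝ} (hα : 0 < α) : (hFloor α : ℝ) < α ∧ α ≤ hFloor α + 1 := by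
  have h0 : 0 ≤ ⌈α⌉ - 1 := by have := Int.ceil_pos.2 hα; omega
  have h1 : (hFloor α : ℝ) = (⌈α⌉ : ℝ) - 1 := by
    have : ((hFloor α : ℕ) : ℤ) = ⌈α⌉ - 1 := Int.toNat_of_nonneg h0
    exact_mod_cast congrArg (Int.cast : ℤ → ℝ) this
  rw [h1]
  exact ⟨by linarith [Int.ceil_lt_add_one α], by linarith [Int.le_ceil α]⟩

theorem holderSemi_nonneg (α : ℝ) (E : Set ℝ) (f : ℝ → ℝ) : 0 ≤ holderSemi α E f := by
  refine Real.sSup_nonneg ?_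
  rintro _ ⟨x, _, y, _, _, rfl⟩
  positivity

theorem div_le_of_holder_bound {α C : ℝ} {x y d : ℝ} (hxy : x ≠ y)
    (h : d ≤ C * |x - y| ^ α) : d / |x - y| ^ α ≤ C :=
  (div_le_iff₀ (Real.rpow_pos_of_pos (abs_pos.2 (sub_ne_zero.2 hxy)) α)).2 h

theorem HolderMem.bddAbove {α : ℝ} {E : Set ℝ} {f : ℝ → ℝ} (hf : HolderMem α E f) :
    BddAbove {c : ℝ | ∃ x ∈ E, ∃ y ∈ E, x ≠ y ∧
      c = |iteratedDerivWithin (hFloor α) f E x - iteratedDerivWithin (hFloor α) f E y| /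
          |x - y| ^ (α - (hFloor α : ℝ))} := by
  obtain ⟨-, C, hC⟩ := hf
  refine ⟨C, ?_⟩
  rintro _ ⟨x, hx, y, hy, hxy, rfl⟩
  exact div_le_of_holder_bound hxy (hC x hx y hy)

theorem HolderMem.abs_sub_le {α : ℝ} {E : Set ℝ} {f : ℝ → ℝ} (hf : HolderMem α E f)
    {x y : ℝ} (hx : x ∈ E) (hy : y ∈ E) :
    |iteratedDerivWithin (hFloor α) f E x - iteratedDerivWithin (hFloor α) f E y|
      ≤ holderSemi α E f * |x - y| ^ (α - (hFloor α : ℝ)) := by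
  rcases eq_or_ne x y with rfl | hxy
  · rw [sub_self, abs_zero]
    exact mul_nonneg (holderSemi_nonneg α E f) (by positivity)
  · rw [← div_le_iff₀ (Real.rpow_pos_of_pos (abs_pos.2 (sub_ne_zero.2 hxy)) _)]
    exact le_csSup hf.bddAbove ⟨x, hx, y, hy, hxy, rfl⟩

theorem holderSemi_le {α C : ℝ} {E : Set ℝ} {f : ℝ → ℝ} (hC : 0 ≤ C)
    (h : ∀ x ∈ E, ∀ y ∈ E,
      |iteratedDerivWithin (hFloor α) f E x - iteratedDerivWithin (hFloor α) f E y|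
        ≤ C * |x - y| ^ (α - (hFloor α : ℝ))) : holderSemi α E f ≤ C := by
  refine Real.sSup_le ?_ hC
  rintro _ ⟨x, hx, y, hy, hxy, rfl⟩
  exact div_le_of_holder_bound hxy (h x hx y hy)

theorem stmt10 (α : ℝ) (hα : 0 < α) (E : Set ℝ) (hEne : E.Nonempty)
    (hE : E.OrdConnected) (f0 : ℝ → ℝ) (hf0 : HolderMem α E f0) :
    ∃ ftil : ℝ → ℝ,
      ContDiff ℝ (hFloor α) ftil ∧
      Set.EqOn ftil f0 E ∧
      HolderMem α Set.univ ftil ∧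
      holderSemi α Set.univ ftil = holderSemi α E f0 := by
  rcases E.subsingleton_or_nontrivial with hs | hn
  · obtain ⟨x₀, hx₀⟩ := hEne
    have hsemi : ∀ x ∈ Set.univ, ∀ y ∈ Set.univ,
        |iteratedDerivWithin (hFloor α) (fun _ : ℝ => f0 x₀) Set.univ x -
          iteratedDerivWithin (hFloor α) (fun _ : ℝ => f0 x₀) Set.univ y|
          ≤ 0 * |x - y| ^ (α - (hFloor α : ℝ)) := by
      intro x _ y _
      simp [iteratedDerivWithin_const]
    refine ⟨fun _ => f0 x₀, contDiff_const, fun x hx => by rw [hs hx hx₀],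
      ⟨contDiffOn_const, 0, hsemi⟩, ?_⟩
    rw [le_antisymm (holderSemi_le le_rfl hsemi) (holderSemi_nonneg _ _ _)]
    refine le_antisymm (holderSemi_nonneg _ _ _) (holderSemi_le le_rfl fun x hx y hy => ?_)
    simp [hs hx hy]
  · have hconv : Convex ℝ E := hE.convex
    have hU : UniqueDiffOn ℝ E :=
      uniqueDiffOn_convex hconv (hconv.nontrivial_iff_nonempty_interior.1 hn)
    obtain ⟨h1, h2⟩ := hFloor_lt hα
    obtain ⟨G, hgG, hG⟩ := exists_holder_extension (β := α - hFloor α)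
      (g := iteratedDerivWithin (hFloor α) f0 E) (by linarith)
      (by linarith) (holderSemi_nonneg α E f0) fun x hx y hy => hf0.abs_sub_le hx hy
    obtain ⟨F, hF, hFf, hFG⟩ := exists_contDiff_extension hconv hU hEne
      (continuous_of_holder_bound (by linarith) hG) (hFloor α) f0 hf0.1 hgG
    rw [← hFG, ← iteratedDerivWithin_univ] at hG hgG
    have hmem : HolderMem α Set.univ F := ⟨hF.contDiffOn, _, fun x _ y _ => hG x y⟩
    refine ⟨F, hF, hFf, hmem, le_antisymm
      (holderSemi_le (holderSemi_nonneg α E f0) fun x _ y _ => hG x y)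
      (holderSemi_le (holderSemi_nonneg _ _ _) fun x hx y hy => ?_)⟩
    rw [hgG hx, hgG hy]
    exact hmem.abs_sub_le (Set.mem_univ x) (Set.mem_univ y)
end

section
/- Let n ∈ ℕ and let P be a real polynomial of degree at most n. Then for every s ∈ (0,1): max_{t∈[0,1]} |P(t)| ≤ e^{n√(6/s)} · max_{t∈[0,s]} |P(t)|, and likewise max_{t∈[0,1]} |P(t)| ≤ e^{n√(6/s)} · max_{t∈[1−s,1]} |P(t)|. -/
open MeasureTheory

namespace Polynomial

/-- The Chebyshev polynomial `T n` grows at most like `exp (n * √(2 * (x - 1)))` on `[1, ∞)`. -/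
theorem Chebyshev.eval_T_real_le_exp (n : ℕ) {x : ℝ} (hx : 1 ≤ x) :
    (Chebyshev.T ℝ n).eval x ≤ Real.exp (n * √(2 * (x - 1))) := by
  set θ := Real.arcosh x
  have hθ : 0 ≤ θ := Real.arcosh_nonneg hx
  have hcosh : Real.cosh θ = x := Real.cosh_arcosh hx
  have hle : θ ≤ √(2 * (x - 1)) := by
    apply Real.le_sqrt_of_sq_le
    have hsinh : θ / 2 ≤ Real.sinh (θ / 2) := Real.self_le_sinh_iff.2 (by positivity)
    have hdouble : Real.cosh θ = Real.cosh (θ / 2) ^ 2 + Real.sinh (θ / 2) ^ 2 := by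
      rw [← Real.cosh_two_mul, mul_div_cancel₀ _ two_ne_zero]
    nlinarith [Real.cosh_sq (θ / 2)]
  calc (Chebyshev.T ℝ n).eval x = Real.cosh (n * θ) := by
        rw [← hcosh, Chebyshev.T_real_cosh, Int.cast_natCast]
    _ ≤ Real.exp (n * θ) := by
        rw [Real.cosh_eq]
        have : Real.exp (-(n * θ)) ≤ Real.exp (n * θ) :=
          Real.exp_le_exp.2 (by linarith [mul_nonneg n.cast_nonneg hθ])
        linarith
    _ ≤ Real.exp (n * √(2 * (x - 1))) := by gcongr

/-- A polynomial bounded on `[-1, 1]` grows at most like a Chebyshev polynomial on `[1, ∞)`. -/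
theorem abs_eval_le_mul_eval_T {n : ℕ} {P : ℝ[X]} (hP : P.natDegree ≤ n) {M : ℝ}
    (hM : ∀ y ∈ Set.Icc (-1 : ℝ) 1, |P.eval y| ≤ M) {x : ℝ} (hx : 1 ≤ x) :
    |P.eval x| ≤ M * (Chebyshev.T ℝ n).eval x := by
  have hM0 : 0 ≤ M := (abs_nonneg _).trans (hM 0 (by norm_num))
  rcases hM0.eq_or_lt with rfl | hMpos
  · have hP0 : P = 0 := eq_zero_of_infinite_isRoot P <|
      (Set.Icc_infinite (show (-1 : ℝ) < 1 by norm_num)).mono fun y hy =>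
        abs_nonpos_iff.1 (hM y hy)
    simp [hP0]
  · have key (c : ℝ) (hc : |c| = 1) : c * P.eval x ≤ M * (Chebyshev.T ℝ n).eval x := by
      have h := Chebyshev.eval_iterate_derivative_le_of_forall_abs_le_one (n := n)
        (P := C (c / M) * P) (k := 0) hx
        (natDegree_le_iff_degree_le.1 ((natDegree_C_mul_le _ _).trans hP)) fun y hy => by
          rw [eval_mul, eval_C, abs_mul, abs_div, hc, abs_of_pos hMpos, one_div_mul_eq_div]
          exact (div_le_one hMpos).2 (hM y hy)
      rw [Function.iterate_zero_apply, Function.iterate_zero_apply, eval_mul, eval_C,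
        div_mul_eq_mul_div, div_le_iff₀' hMpos] at h
      exact h
    refine abs_le'.2 ⟨?_, ?_⟩
    · simpa using key 1 (by simp)
    · simpa using key (-1) (by simp)

/-- Remez-type inequality: on `[0, 1]` a polynomial is controlled by its values on `[0, s]`. -/
theorem abs_eval_le_exp_mul_of_forall_Icc {n : ℕ} {P : ℝ[X]} (hP : P.natDegree ≤ n)
    {s : ℝ} (hs : 0 < s) {M : ℝ} (hM : ∀ u ∈ Set.Icc 0 s, |P.eval u| ≤ M)
    {t : ℝ} (ht : t ∈ Set.Icc (0 : ℝ) 1) :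
    |P.eval t| ≤ Real.exp (n * √(6 / s)) * M := by
  have hM0 : 0 ≤ M := (abs_nonneg _).trans (hM 0 ⟨le_rfl, hs.le⟩)
  rcases le_total t s with hts | hst
  · exact (hM t ⟨ht.1, hts⟩).trans
      (le_mul_of_one_le_left hM0 (Real.one_le_exp (by positivity)))
  · set Q : ℝ[X] := P.comp (C (s / 2) * X + C (s / 2))
    have hQ : Q.natDegree ≤ n := by
      calc Q.natDegree ≤ P.natDegree * (C (s / 2) * X + C (s / 2)).natDegree :=
            natDegree_comp_le
        _ ≤ P.natDegree * 1 := by gcongr; exact natDegree_linear_le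
        _ ≤ n := by simpa using hP
    have hQeval (y : ℝ) : Q.eval y = P.eval (s / 2 * y + s / 2) := by simp [Q]
    have hx : 1 ≤ 2 * t / s - 1 := by
      have : 2 ≤ 2 * t / s := (le_div_iff₀ hs).2 (by linarith)
      linarith
    have hQx : Q.eval (2 * t / s - 1) = P.eval t := by
      rw [hQeval]
      congr 1
      field_simp
      ring
    have hQM (y : ℝ) (hy : y ∈ Set.Icc (-1 : ℝ) 1) : |Q.eval y| ≤ M := by
      rw [hQeval]
      exact hM _ ⟨by nlinarith [hy.1], by nlinarith [hy.2]⟩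
    have hexp : 2 * (2 * t / s - 1 - 1) ≤ 6 / s := by
      have : 2 * (2 * t / s - 1 - 1) = (4 * t - 4 * s) / s := by
        field_simp
        ring
      rw [this]
      gcongr
      linarith [ht.2]
    calc |P.eval t| = |Q.eval (2 * t / s - 1)| := by rw [hQx]
      _ ≤ M * (Chebyshev.T ℝ n).eval (2 * t / s - 1) := abs_eval_le_mul_eval_T hQ hQM hx
      _ ≤ M * Real.exp (n * √(2 * (2 * t / s - 1 - 1))) := by
          gcongr
          exact Chebyshev.eval_T_real_le_exp n hx
      _ ≤ M * Real.exp (n * √(6 / s)) := by gcongr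
      _ = Real.exp (n * √(6 / s)) * M := mul_comm _ _

theorem abs_eval_le_iSup_Icc (P : ℝ[X]) {a b u : ℝ} (hu : u ∈ Set.Icc a b) :
    |P.eval u| ≤ ⨆ v : Set.Icc a b, |P.eval (v : ℝ)| :=
  le_ciSup (f := fun v : Set.Icc a b => |P.eval (v : ℝ)|)
    (isCompact_range (by fun_prop)).bddAbove ⟨u, hu⟩

end Polynomial

theorem stmt11 (n : ℕ) (P : Polynomial ℝ) (hP : P.natDegree ≤ n)
    (s : ℝ) (hs : s ∈ Set.Ioo (0:ℝ) 1) :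
    (∀ t ∈ Set.Icc (0:ℝ) 1, |P.eval t| ≤
        Real.exp ((n:ℝ) * Real.sqrt (6 / s)) * ⨆ u : Set.Icc (0:ℝ) s, |P.eval (u:ℝ)|) ∧
    (∀ t ∈ Set.Icc (0:ℝ) 1, |P.eval t| ≤
        Real.exp ((n:ℝ) * Real.sqrt (6 / s)) * ⨆ u : Set.Icc (1 - s) (1:ℝ), |P.eval (u:ℝ)|) := by
  refine ⟨fun t ht => ?_, fun t ht => ?_⟩
  · exact Polynomial.abs_eval_le_exp_mul_of_forall_Icc hP hs.1
      (fun u hu => P.abs_eval_le_iSup_Icc hu) ht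
  · have hdeg : (P.comp (1 - Polynomial.X)).natDegree ≤ n := by
      calc (P.comp (1 - Polynomial.X)).natDegree
          ≤ P.natDegree * (1 - Polynomial.X : Polynomial ℝ).natDegree :=
            Polynomial.natDegree_comp_le
        _ ≤ P.natDegree * 1 := by
            gcongr
            exact (Polynomial.natDegree_sub_le _ _).trans (by simp)
        _ ≤ n := by simpa using hP
    have h := Polynomial.abs_eval_le_exp_mul_of_forall_Icc hdeg hs.1
      (M := ⨆ u : Set.Icc (1 - s) (1 : ℝ), |P.eval (u : ℝ)|)
      (fun u hu => by
        simpa using P.abs_eval_le_iSup_Icc (u := 1 - u) (a := 1 - s) (b := 1)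
          ⟨by linarith [hu.2], by linarith [hu.1]⟩)
      (t := 1 - t) ⟨by linarith [ht.2], by linarith [ht.1]⟩
    simpa using h
end

section
/- Let n ∈ ℕ and let P be a real polynomial of degree at most n. Then for every s ∈ (0,1): ∫_0^1 |P(u)| du ≤ e^{n√(6/s)} · (2/s) · (n+1)² · ∫_0^s |P(u)| du, and likewise ∫_0^1 |P(u)| du ≤ e^{n√(6/s)} · (2/s) · (n+1)² · ∫_{1−s}^1 |P(u)| du. -/
open MeasureTheory

open Polynomial in
theorem Polynomial.exists_derivative_eq_of_natDegree_le {n : ℕ} {P : ℝ[X]}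
    (hP : P.natDegree ≤ n) : ∃ Q : ℝ[X], Q.natDegree ≤ n + 1 ∧ derivative Q = P := by
  refine ⟨∑ i ∈ Finset.range (n + 1), C (P.coeff i / (i + 1)) * X ^ (i + 1), ?_, ?_⟩
  · refine natDegree_sum_le_of_forall_le _ _ fun i hi => ?_
    exact (natDegree_C_mul_X_pow_le _ _).trans (Finset.mem_range.mp hi)
  · rw [derivative_sum]
    conv_rhs => rw [P.as_sum_range_C_mul_X_pow' (Nat.lt_succ_of_le hP)]
    refine Finset.sum_congr rfl fun i _ => ?_
    have : (i : ℝ) + 1 ≠ 0 := by positivity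
    rw [derivative_C_mul_X_pow]
    simp [div_mul_cancel₀ _ this]

theorem Polynomial.intervalIntegrable_abs_eval (P : Polynomial ℝ) (a b : ℝ) :
    IntervalIntegrable (fun x => |P.eval x|) volume a b :=
  P.continuous.abs.intervalIntegrable a b

theorem Polynomial.integral_eval_derivative (P : Polynomial ℝ) (a b : ℝ) :
    ∫ x in a..b, P.derivative.eval x = P.eval b - P.eval a :=
  intervalIntegral.integral_eq_sub_of_hasDerivAt (fun x _ => P.hasDerivAt x)
    (P.derivative.continuous.intervalIntegrable a b)

namespace Polynomial.Chebyshev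

/-- Outside `[-1, 1]`, the derivative of a polynomial bounded by `M` on `[-1, 1]` is dominated by
that of `M` times the Chebyshev polynomial. -/
theorem abs_eval_derivative_le_of_forall_abs_le {n : ℕ} {P : ℝ[X]} {M x : ℝ} (hM : 0 < M)
    (hx : 1 ≤ x) (hPdeg : P.natDegree ≤ n) (hPbnd : ∀ y ∈ Set.Icc (-1) 1, |P.eval y| ≤ M) :
    |P.derivative.eval x| ≤ M * (T ℝ n).derivative.eval x := by
  have key : ∀ ε : ℝ, |ε| = 1 → ε * P.derivative.eval x ≤ M * (T ℝ n).derivative.eval x := by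
    intro ε hε
    have h := eval_iterate_derivative_le_of_forall_abs_le_one (k := 1) (P := Polynomial.C (ε / M) * P) hx
      (degree_le_of_natDegree_le ((natDegree_C_mul_le _ _).trans hPdeg)) fun y hy => by
        rw [eval_C_mul, abs_mul, abs_div, hε, abs_of_pos hM, one_div_mul_eq_div]
        exact (div_le_one hM).mpr (hPbnd y hy)
    simp only [Function.iterate_one, derivative_C_mul, eval_C_mul] at h
    rwa [div_mul_eq_mul_div, div_le_iff₀' hM] at h
  exact abs_le'.mpr ⟨by simpa using key 1 (by simp), by simpa using key (-1) (by simp)⟩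

/-- A Remez-type inequality in `L¹`. -/
theorem integral_abs_eval_le {n : ℕ} {P : ℝ[X]} (hP : P.natDegree ≤ n) {a : ℝ} (ha : 1 ≤ a) :
    ∫ x in (-1)..a, |P.eval x| ≤ (T ℝ (n + 1 : ℕ)).eval a * ∫ x in (-1)..1, |P.eval x| := by
  obtain ⟨Q, hQ, rfl⟩ := exists_derivative_eq_of_natDegree_le hP
  have hint := Q.derivative.intervalIntegrable_abs_eval
  set M := ∫ x in (-1)..1, |Q.derivative.eval x|
  have hM0 : 0 ≤ M := intervalIntegral.integral_nonneg (by norm_num) fun _ _ => abs_nonneg _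
  have hbound : ∀ y ∈ Set.Icc (-1 : ℝ) 1, |(Q - Polynomial.C (Q.eval (-1))).eval y| ≤ M := by
    intro y hy
    rw [eval_sub, eval_C, ← Q.integral_eval_derivative]
    refine (intervalIntegral.abs_integral_le_integral_abs hy.1).trans ?_
    exact intervalIntegral.integral_mono_interval le_rfl hy.1 hy.2
      (Filter.Eventually.of_forall fun _ => abs_nonneg _) (hint _ _)
  have hdeg : (Q - Polynomial.C (Q.eval (-1))).natDegree ≤ n + 1 := by
    rwa [natDegree_sub_C]
  have houter : ∫ x in 1..a, |Q.derivative.eval x| ≤ M * ((T ℝ (n + 1 : ℕ)).eval a - 1) := by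
    have hlim : Filter.Tendsto (fun M' => M' * ((T ℝ (n + 1 : ℕ)).eval a - 1))
        (nhdsWithin M (Set.Ioi M)) (nhds (M * ((T ℝ (n + 1 : ℕ)).eval a - 1))) :=
      ((continuous_id.mul continuous_const).tendsto M).mono_left nhdsWithin_le_nhds
    refine ge_of_tendsto hlim (Filter.eventually_of_mem self_mem_nhdsWithin fun M' hM' => ?_)
    have hM' : M < M' := hM'
    calc ∫ x in 1..a, |Q.derivative.eval x|
        ≤ ∫ x in 1..a, M' * (T ℝ (n + 1 : ℕ)).derivative.eval x := by
          refine intervalIntegral.integral_mono_on ha (hint _ _)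
            ((continuous_const.mul (Polynomial.continuous _)).intervalIntegrable _ _) fun x hx => ?_
          simpa using abs_eval_derivative_le_of_forall_abs_le (hM0.trans_lt hM') hx.1 hdeg
            fun y hy => (hbound y hy).trans hM'.le
      _ = M' * ((T ℝ (n + 1 : ℕ)).eval a - 1) := by
          rw [intervalIntegral.integral_const_mul, integral_eval_derivative, T_eval_one]
  rw [← intervalIntegral.integral_add_adjacent_intervals (hint _ 1) (hint _ _)]
  linarith

theorem eval_T_succ_cosh_le (n : ℕ) {θ : ℝ} (hθ : 0 ≤ θ) :
    (T ℝ (n + 1 : ℕ)).eval (Real.cosh θ) ≤ Real.exp (n * θ) * Real.cosh θ := by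
  have h : Real.exp (-(n * θ)) ≤ Real.exp (n * θ) :=
    Real.exp_le_exp.mpr (neg_le_self (by positivity))
  have hmul := mul_le_mul_of_nonneg_right h (Real.exp_pos (-θ)).le
  rw [T_real_cosh]
  push_cast
  rw [Real.cosh_eq, Real.cosh_eq, add_mul, one_mul, neg_add, Real.exp_add, Real.exp_add]
  linarith

end Polynomial.Chebyshev

theorem Real.one_add_sq_div_two_le_cosh {x : ℝ} (hx : 0 ≤ x) : 1 + x ^ 2 / 2 ≤ Real.cosh x := by
  have h : x / 2 ≤ Real.sinh (x / 2) := Real.self_le_sinh_iff.mpr (by positivity)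
  have h2 : Real.cosh x = 1 + 2 * Real.sinh (x / 2) ^ 2 := by
    rw [← mul_div_cancel₀ x (two_ne_zero' ℝ), mul_div_assoc, Real.cosh_two_mul, Real.cosh_sq]
    ring_nf
  nlinarith [pow_le_pow_left₀ (by positivity) h 2]

theorem Real.arcosh_two_div_sub_one_le {s : ℝ} (hs0 : 0 < s) (hs1 : s ≤ 1) :
    Real.arcosh (2 / s - 1) ≤ √(6 / s) := by
  have h1 : 1 ≤ 1 / s := (one_le_div hs0).mpr hs1
  have h2 : 2 / s = 2 * (1 / s) := by ring
  have h6 : 6 / s = 6 * (1 / s) := by ring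
  rw [← Real.arcosh_cosh (Real.sqrt_nonneg (6 / s)),
    Real.arcosh_le_arcosh (by linarith) (Real.cosh_pos _)]
  have := Real.one_add_sq_div_two_le_cosh (Real.sqrt_nonneg (6 / s))
  rw [Real.sq_sqrt (by positivity)] at this
  linarith

theorem Polynomial.integral_abs_eval_zero_one_le {n : ℕ} {P : Polynomial ℝ} (hP : P.natDegree ≤ n)
    {s : ℝ} (hs0 : 0 < s) (hs1 : s ≤ 1) :
    ∫ u in (0:ℝ)..1, |P.eval u| ≤
      Real.exp (n * √(6 / s)) * (2 / s) * ∫ u in (0:ℝ)..s, |P.eval u| := by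
  have h1 : 1 ≤ 1 / s := (one_le_div hs0).mpr hs1
  have h2 : 2 / s = 2 * (1 / s) := by ring
  have ha : 1 ≤ 2 / s - 1 := by linarith
  set R := P.comp (C (s / 2) * X + C (s / 2)) with hR
  have hRdeg : R.natDegree ≤ n := by
    refine natDegree_comp_le.trans ((Nat.mul_le_mul hP natDegree_linear_le).trans ?_)
    simp
  have hRint : ∀ b, ∫ x in (-1)..b, |R.eval x| =
      (s / 2)⁻¹ * ∫ u in (0:ℝ)..(s / 2 * b + s / 2), |P.eval u| := by
    intro b
    have := intervalIntegral.integral_comp_mul_add (a := -1) (b := b) (fun u => |P.eval u|)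
      (half_pos hs0).ne' (s / 2)
    simpa [hR, eval_comp] using this
  have hrem := Polynomial.Chebyshev.integral_abs_eval_le hRdeg ha
  have e1 : s / 2 * (2 / s - 1) + s / 2 = 1 := by field_simp; ring
  have e2 : s / 2 * 1 + s / 2 = s := by ring
  rw [hRint, hRint, e1, e2, mul_left_comm, mul_le_mul_iff_right₀ (by positivity)] at hrem
  have hM : 0 ≤ ∫ u in (0:ℝ)..s, |P.eval u| :=
    intervalIntegral.integral_nonneg hs0.le fun _ _ => abs_nonneg _
  refine hrem.trans (mul_le_mul_of_nonneg_right ?_ hM)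
  have hT := Polynomial.Chebyshev.eval_T_succ_cosh_le n (Real.arcosh_nonneg ha)
  rw [Real.cosh_arcosh ha] at hT
  refine hT.trans (mul_le_mul ?_ (by linarith) (by linarith) (Real.exp_pos _).le)
  gcongr
  exact Real.arcosh_two_div_sub_one_le hs0 hs1

theorem stmt12 (n : ℕ) (P : Polynomial ℝ) (hP : P.natDegree ≤ n)
    (s : ℝ) (hs : s ∈ Set.Ioo (0:ℝ) 1) :
    ((∫ u in (0:ℝ)..1, |P.eval u|) ≤
        Real.exp ((n:ℝ) * Real.sqrt (6 / s)) * (2 / s) * ((n:ℝ) + 1) ^ 2 *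
          ∫ u in (0:ℝ)..s, |P.eval u|) ∧
    ((∫ u in (0:ℝ)..1, |P.eval u|) ≤
        Real.exp ((n:ℝ) * Real.sqrt (6 / s)) * (2 / s) * ((n:ℝ) + 1) ^ 2 *
          ∫ u in (1 - s)..(1:ℝ), |P.eval u|) := by
  obtain ⟨hs0, hs1⟩ := hs
  have key : ∀ Q : Polynomial ℝ, Q.natDegree ≤ n → (∫ u in (0:ℝ)..1, |Q.eval u|) ≤
      Real.exp ((n:ℝ) * Real.sqrt (6 / s)) * (2 / s) * ((n:ℝ) + 1) ^ 2 *
        ∫ u in (0:ℝ)..s, |Q.eval u| := by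
    intro Q hQ
    have hM : 0 ≤ ∫ u in (0:ℝ)..s, |Q.eval u| :=
      intervalIntegral.integral_nonneg hs0.le fun _ _ => abs_nonneg _
    refine (Polynomial.integral_abs_eval_zero_one_le hQ hs0 hs1.le).trans ?_
    refine mul_le_mul_of_nonneg_right (le_mul_of_one_le_right (by positivity) ?_) hM
    exact one_le_pow₀ (by linarith [n.cast_nonneg (α := ℝ)])
  refine ⟨key P hP, ?_⟩
  have h := key (P.comp (1 - Polynomial.X)) <| by
    have hX : (1 - Polynomial.X : Polynomial ℝ).natDegree ≤ 1 := by compute_degree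
    exact Polynomial.natDegree_comp_le.trans ((Nat.mul_le_mul hP hX).trans (by simp))
  have hsub := fun b => intervalIntegral.integral_comp_sub_left (fun u => |P.eval u|) (a := 0) (b := b) (d := 1)
  simp only [Polynomial.eval_comp, Polynomial.eval_sub, Polynomial.eval_one, Polynomial.eval_X,
    hsub] at h
  simpa using h
end

section
/- For every R ≥ 1 there exists a constant c(R) > 0 such that for all a ∈ (0,R], all y ∈ [0,1] and all ξ ∈ (0,1/2]: ( Γ(2a) / Γ(a)² ) · ∫_{max(y−ξ,0)}^{min(y+ξ,1)} t^{a−1} (1−t)^{a−1} dt ≥ c(R) · a² · ξ^R. (This is a lower bound on the probability that a Beta(a,a) random variable lies within ξ of y.) -/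
open MeasureTheory

lemma intervalIntegrable_rpow_mul_one_sub_rpow {a : ℝ} (ha : 0 < a) :
    IntervalIntegrable (fun t : ℝ => t ^ (a - 1) * (1 - t) ^ (a - 1)) volume 0 1 := by
  have h := (Complex.betaIntegral_convergent (u := a) (v := a) (by simpa) (by simpa)).norm
  refine h.congr_uIoo fun t ht => ?_
  rw [Set.uIoo_of_le zero_le_one] at ht
  have h1 : 0 < 1 - t := by linarith [ht.2]
  have e : (1 : ℂ) - t = ((1 - t : ℝ) : ℂ) := by push_cast; ring
  simp only [norm_mul]
  rw [e, Complex.norm_cpow_eq_rpow_re_of_pos ht.1, Complex.norm_cpow_eq_rpow_re_of_pos h1]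
  simp

lemma exists_mul_le_Gamma_two_mul_div_Gamma_sq (R : ℝ) (hR : 0 ≤ R) :
    ∃ m : ℝ, 0 < m ∧ ∀ a : ℝ, 0 < a → a ≤ R →
      m * a ≤ Real.Gamma (2 * a) / Real.Gamma a ^ 2 := by
  have hpos : ∀ a ∈ Set.Icc (0 : ℝ) R,
      0 < Real.Gamma (2 * a + 1) / Real.Gamma (a + 1) ^ 2 := fun a ha =>
    div_pos (Real.Gamma_pos_of_pos (by linarith [ha.1]))
      (pow_pos (Real.Gamma_pos_of_pos (by linarith [ha.1])) 2)
  have hc : ContinuousOn (fun a : ℝ => Real.Gamma (2 * a + 1) / Real.Gamma (a + 1) ^ 2)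
      (Set.Icc 0 R) := by
    have hG : ∀ x : ℝ, 0 < x → ContinuousAt Real.Gamma x := fun x hx =>
      (Real.differentiableAt_Gamma fun n => by
        have : (0 : ℝ) ≤ n := n.cast_nonneg
        linarith).continuousAt
    intro a ha
    refine ContinuousAt.continuousWithinAt (ContinuousAt.div ?_ (ContinuousAt.pow ?_ 2) ?_)
    · exact ContinuousAt.comp' (hG _ (by linarith [ha.1])) (by fun_prop)
    · exact ContinuousAt.comp' (hG _ (by linarith [ha.1])) (by fun_prop)
    · exact (pow_pos (Real.Gamma_pos_of_pos (by linarith [ha.1])) 2).ne'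
  obtain ⟨b, hb, hmin⟩ := isCompact_Icc.exists_isMinOn ⟨0, le_refl 0, hR⟩ hc
  refine ⟨_ / 2, half_pos (hpos b hb), fun a ha haR => ?_⟩
  have h := hmin (Set.mem_Icc.2 ⟨ha.le, haR⟩)
  simp only [Set.mem_ofPred_eq] at h
  have hΓ := (Real.Gamma_pos_of_pos ha).ne'
  have key : Real.Gamma (2 * a) / Real.Gamma a ^ 2
      = Real.Gamma (2 * a + 1) / Real.Gamma (a + 1) ^ 2 / 2 * a := by
    rw [Real.Gamma_add_one (by positivity : 2 * a ≠ 0), Real.Gamma_add_one ha.ne']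
    field_simp
  rw [key]
  gcongr

lemma rpow_le_integral_rpow_mul_one_sub_rpow {R a y ξ : ℝ} (hR : 1 ≤ R) (ha : 0 < a)
    (haR : a ≤ R) (hy : y ∈ Set.Icc (0 : ℝ) 1) (hξ : 0 < ξ) (hξ' : ξ ≤ 1 / 2) :
    ξ / 2 * (ξ / 8) ^ (R - 1) ≤
      ∫ t in (max (y - ξ) 0)..(min (y + ξ) 1), t ^ (a - 1) * (1 - t) ^ (a - 1) := by
  obtain ⟨s, hs0, hs1, hsl, hsu⟩ : ∃ s : ℝ, 0 ≤ s ∧ s + ξ ≤ 1 ∧ y - ξ ≤ s ∧ s ≤ y := by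
    rcases le_total y (1 / 2) with h | h
    · exact ⟨y, hy.1, by linarith, by linarith, le_rfl⟩
    · exact ⟨y - ξ, by linarith, by linarith [hy.2], le_rfl, by linarith⟩
  have hl : max (y - ξ) 0 ≤ s + ξ / 4 := max_le (by linarith) (by linarith)
  have hu : s + 3 * ξ / 4 ≤ min (y + ξ) 1 := le_min (by linarith) (by linarith)
  have hm : s + ξ / 4 ≤ s + 3 * ξ / 4 := by linarith
  have h0 : 0 ≤ max (y - ξ) 0 := le_max_right _ _
  have h1 : min (y + ξ) 1 ≤ 1 := min_le_right _ _
  have hint := intervalIntegrable_rpow_mul_one_sub_rpow ha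
  have hsub : ∀ p q : ℝ, 0 ≤ p → p ≤ q → q ≤ 1 →
      IntervalIntegrable (fun t : ℝ => t ^ (a - 1) * (1 - t) ^ (a - 1)) volume p q :=
    fun p q hp hpq hq => hint.mono_set (by
      rw [Set.uIcc_of_le hpq, Set.uIcc_of_le zero_le_one]
      exact Set.Icc_subset_Icc hp hq)
  calc ξ / 2 * (ξ / 8) ^ (R - 1)
      = ∫ _ in (s + ξ / 4)..(s + 3 * ξ / 4), (ξ / 8) ^ (R - 1) := by
        rw [intervalIntegral.integral_const, smul_eq_mul]; ring
    _ ≤ ∫ t in (s + ξ / 4)..(s + 3 * ξ / 4), t ^ (a - 1) * (1 - t) ^ (a - 1) := by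
        refine intervalIntegral.integral_mono_on hm (by simp)
          (hsub _ _ (by linarith) hm (by linarith)) fun t ht => ?_
        have ht0 : ξ / 4 ≤ t := by linarith [ht.1]
        have ht1 : ξ / 4 ≤ 1 - t := by linarith [ht.2]
        have hprod : ξ / 8 ≤ t * (1 - t) := by
          rcases le_total t (1 / 2) with h | h <;> nlinarith
        rw [← Real.mul_rpow (by linarith) (by linarith)]
        calc (ξ / 8) ^ (R - 1) ≤ (t * (1 - t)) ^ (R - 1) :=
              Real.rpow_le_rpow (by positivity) hprod (by linarith)
          _ ≤ (t * (1 - t)) ^ (a - 1) :=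
              Real.rpow_le_rpow_of_exponent_ge (by linarith) (by nlinarith) (by linarith)
    _ ≤ _ := by
        refine intervalIntegral.integral_mono_interval hl hm hu ?_
          (hsub _ _ h0 (hl.trans (hm.trans hu)) h1)
        refine (ae_restrict_iff' measurableSet_Ioc).2 (.of_forall fun t ht => ?_)
        exact mul_nonneg (Real.rpow_nonneg (h0.trans ht.1.le) _)
          (Real.rpow_nonneg (by linarith [ht.2]) _)

theorem stmt19 (R : ℝ) (hR : 1 ≤ R) :
    ∃ c : ℝ, 0 < c ∧ ∀ a : ℝ, 0 < a → a ≤ R → ∀ y ∈ Set.Icc (0:ℝ) 1,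
      ∀ ξ : ℝ, 0 < ξ → ξ ≤ 1/2 →
        c * a ^ 2 * ξ ^ R ≤
          (Real.Gamma (2*a) / (Real.Gamma a) ^ 2) *
            ∫ t in (max (y - ξ) 0)..(min (y + ξ) 1), t ^ (a - 1) * (1 - t) ^ (a - 1) := by
  have hR0 : 0 < R := by linarith
  obtain ⟨m, hm, hΓ⟩ := exists_mul_le_Gamma_two_mul_div_Gamma_sq R hR0.le
  refine ⟨m / R * (1 / 2 * (1 / 8) ^ (R - 1)), by positivity, fun a ha haR y hy ξ hξ hξ' => ?_⟩
  have hI := rpow_le_integral_rpow_mul_one_sub_rpow hR ha haR hy hξ hξ'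
  have hpow : ξ / 2 * (ξ / 8) ^ (R - 1) = 1 / 2 * (1 / 8) ^ (R - 1) * ξ ^ R := by
    have e : ξ ^ R = ξ * ξ ^ (R - 1) := by
      rw [Real.rpow_sub_one hξ.ne']; field_simp
    rw [e, show ξ / 8 = 1 / 8 * ξ by ring, Real.mul_rpow (by norm_num) hξ.le]
    ring
  have hsq : m / R * a ^ 2 ≤ m * a := by
    rw [div_mul_eq_mul_div, div_le_iff₀ hR0]
    nlinarith [mul_le_mul_of_nonneg_left haR (mul_pos hm ha).le]
  calc m / R * (1 / 2 * (1 / 8) ^ (R - 1)) * a ^ 2 * ξ ^ R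
      = (m / R * a ^ 2) * (ξ / 2 * (ξ / 8) ^ (R - 1)) := by rw [hpow]; ring
    _ ≤ _ := mul_le_mul (hsq.trans (hΓ a ha haR)) hI (by positivity)
        ((mul_pos hm ha).le.trans (hΓ a ha haR))
end
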